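/- Let α ∈ (0,1), M > 0, set h̄⁻ := −M, and let ε ∈ (0,1). Then the negative-side NLR test φ_n(·|h̄⁻,ε) is asymptotically uniformly most powerful at level α on [−M, 0): (i) limsup_{n→∞} ∫ φ_n(y|h̄⁻,ε) dP^n_{θ0}(y) ≤ α, and (ii) for every sequence of measurable functions ψ_n : ℝ^n → [0,1] satisfying limsup_{n→∞} ∫ ψ_n dP^n_{θ0} ≤ α and every h with −M ≤ h < 0, liminf_{n→∞} ∫ φ_n(y|h̄⁻,ε) dP^n_{θ0+h/n}(y) ≥ limsup_{n→∞} ∫ ψ_n dP^n_{θ0+h/n}. -/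

import Mathlib

open MeasureTheory Filter Real Topology

noncomputable section

attribute [local instance] Classical.propDecidable

/-- The benchmark nonregular model of Shimizu–Otsu, satisfying Assumption 1.
`f y θ` denotes the density kernel `f(y|θ)` and the data density is
`y ↦ f(y|θ) · 𝟙{y ≥ g θ}`. -/
structure BenchmarkModel where
  θ0 : ℝ
  /-- density kernel, `f y θ = f(y|θ)` -/
  f : ℝ → ℝ → ℝ
  /-- boundary function -/
  g : ℝ → ℝ
  /-- open neighborhood of `θ0` -/
  N : Set ℝ
  /-- uniform bound on `f` over `N` -/
  C : ℝ
  N_open : IsOpen N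
  θ0_mem : θ0 ∈ N
  /-- (a) `y ↦ f(y|θ)·𝟙{y ≥ g θ}` is a probability density for every `θ`. -/
  f_nonneg : ∀ θ y, g θ ≤ y → 0 ≤ f y θ
  f_integrable : ∀ θ, IntegrableOn (fun y => f y θ) (Set.Ici (g θ))
  f_density : ∀ θ, ∫ y in Set.Ici (g θ), f y θ = 1
  /-- (b) `θ ↦ f(y|θ)` is twice continuously differentiable for every `y`. -/
  f_smooth : ∀ y, ContDiff ℝ 2 fun θ => f y θ
  /-- (c) continuity in `y` for `θ ∈ N`, and uniform positive bounds on `N` -/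
  f_cont : ∀ θ ∈ N, Continuous fun y => f y θ
  fθ_cont : ∀ θ ∈ N, Continuous fun y => deriv (fun t => f y t) θ
  f_pos : ∀ θ ∈ N, ∀ y, 0 < f y θ
  f_lt : ∀ θ ∈ N, ∀ y, f y θ < C
  /-- (d) integrability of the suprema over `N` -/
  int1 : ∫⁻ y : ℝ, ⨆ θ ∈ N,
      ENNReal.ofReal (|deriv (fun t => f y t) θ| * if g θ ≤ y then 1 else 0) < ⊤
  int2 : ∫⁻ y : ℝ, ⨆ θ ∈ N, ⨆ θ' ∈ N, ENNReal.ofReal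
      ((deriv (fun t => f y t) θ') ^ 2 / (f y θ') ^ 2 *
        (if g θ ≤ y then 1 else 0) * f y θ) < ⊤
  int3 : ∫⁻ y : ℝ, ⨆ θ ∈ N, ⨆ θ' ∈ N, ENNReal.ofReal
      (|deriv (deriv fun t => f y t) θ'| / f y θ' *
        (if g θ ≤ y then 1 else 0) * f y θ) < ⊤
  /-- (e) conditions on `g` -/
  g_smooth : ContDiff ℝ 1 g
  g_deriv_pos : 0 < deriv g θ0
  g_deriv_bdd : ∃ B, ∀ θ ∈ N, |deriv g θ| ≤ B

namespace BenchmarkModel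

variable (M : BenchmarkModel)

/-- `λ = (f(g(θ0)|θ0)·g'(θ0))⁻¹`. -/
def lam : ℝ := (M.f (M.g M.θ0) M.θ0 * deriv M.g M.θ0)⁻¹

/-- The joint measure `P_θ^n` of an iid sample of size `n` on `ℝ^n`. -/
def P (n : ℕ) (θ : ℝ) : Measure (Fin n → ℝ) :=
  (volume : Measure (Fin n → ℝ)).withDensity fun y =>
    ENNReal.ofReal (∏ i, M.f (y i) θ * if M.g θ ≤ y i then 1 else 0)

/-- The likelihood-ratio statistic `Z_n(h, h̄)`. -/
def Z (n : ℕ) (h hb : ℝ) : (Fin n → ℝ) → ℝ := fun y =>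
  if ∀ i, M.g (M.θ0 + h / n) ≤ y i then
    (if ∀ i, M.g (M.θ0 + hb / n) ≤ y i then 1 else 0) *
      ∏ i, M.f (y i) (M.θ0 + hb / n) / M.f (y i) (M.θ0 + h / n)
  else 0

end BenchmarkModel

namespace BenchmarkModel

variable (M : BenchmarkModel)

/-- The negative-side NLR test `φ_n(·|h̄,ε)` at significance level `α`
(rejection clause taking priority). -/
def phiMinus (n : ℕ) (hb ε α : ℝ) : (Fin n → ℝ) → ℝ := fun y =>
  if exp (hb / M.lam) * (1 + ε) < M.Z n 0 hb y ∨ ∃ i, y i < M.g M.θ0 then 1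
  else if M.Z n 0 hb y ∈ Set.Icc (exp (hb / M.lam) * (1 - ε)) (exp (hb / M.lam) * (1 + ε)) then α
  else 0

end BenchmarkModel

/-- Mean value theorem along the segment from `a` to `a + d`, irrespective of the sign of `d`. -/
lemma exists_segment_deriv_eq {F F' : ℝ → ℝ} {a d : ℝ}
    (hF : ∀ r ∈ Set.Icc (0 : ℝ) 1, HasDerivAt F (F' (a + r * d)) (a + r * d)) :
    ∃ r ∈ Set.Ioo (0 : ℝ) 1, F (a + d) - F a = F' (a + r * d) * d := by
  have hc : ∀ r ∈ Set.Icc (0 : ℝ) 1,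
      HasDerivAt (fun r => F (a + r * d)) (F' (a + r * d) * d) r := fun r hr => by
    have h1 : HasDerivAt (fun r : ℝ => a + r * d) d r := by
      simpa using ((hasDerivAt_id r).mul_const d).const_add a
    exact (hF r hr).comp r h1
  obtain ⟨r, hr, h⟩ := exists_hasDerivAt_eq_slope (fun r => F (a + r * d))
    (fun r => F' (a + r * d) * d) zero_lt_one
    (fun r hr => (hc r hr).continuousAt.continuousWithinAt)
    (fun r hr => hc r (Set.Ioo_subset_Icc_self hr))
  exact ⟨r, hr, by rw [h]; simp⟩

/-- The Cauchy–Schwarz inequality for real square-integrable functions. -/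
lemma integral_abs_mul_le_sqrt {Ω : Type*} [MeasurableSpace Ω] {μ : Measure Ω} {u v : Ω → ℝ}
    (hu : MemLp u 2 μ) (hv : MemLp v 2 μ) :
    ∫ x, |u x * v x| ∂μ ≤ √((∫ x, u x ^ 2 ∂μ) * ∫ x, v x ^ 2 ∂μ) := by
  have h := integral_mul_norm_le_Lp_mul_Lq (μ := μ) (f := u) (g := v) (p := 2) (q := 2)
    Real.HolderConjugate.two_two (by simpa using hu) (by simpa using hv)
  rw [Real.sqrt_mul (integral_nonneg fun _ => sq_nonneg _), Real.sqrt_eq_rpow, Real.sqrt_eq_rpow]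
  simpa [abs_mul] using h

lemma integral_sub_sub_const_mul {Ω : Type*} [MeasurableSpace Ω] {μ : Measure Ω} {u v w : Ω → ℝ}
    (hu : Integrable u μ) (hv : Integrable v μ) (hw : Integrable w μ) (c : ℝ) :
    ∫ x, (u x - v x - c * w x) ∂μ = ∫ x, u x ∂μ - ∫ x, v x ∂μ - c * ∫ x, w x ∂μ := by
  have huv : Integrable (fun x => u x - v x) μ := hu.sub hv
  rw [integral_sub huv (hw.const_mul c), integral_sub hu hv, integral_const_mul]

lemma integral_add_sub_const_mul {Ω : Type*} [MeasurableSpace Ω] {μ : Measure Ω} {u v w : Ω → ℝ}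
    (hu : Integrable u μ) (hv : Integrable v μ) (hw : Integrable w μ) (c : ℝ) :
    ∫ x, (u x + v x - c * w x) ∂μ = ∫ x, u x ∂μ + ∫ x, v x ∂μ - c * ∫ x, w x ∂μ := by
  have huv : Integrable (fun x => u x + v x) μ := hu.add hv
  rw [integral_sub huv (hw.const_mul c), integral_add hu hv, integral_const_mul]

namespace BenchmarkModel

variable (M : BenchmarkModel)

/-- The derivative `∂θ f(y|θ)`. -/
def fDeriv (y θ : ℝ) : ℝ := deriv (fun t => M.f y t) θ

/-- The second derivative `∂θθ f(y|θ)`. -/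
def fDeriv2 (y θ : ℝ) : ℝ := deriv (deriv fun t => M.f y t) θ

lemma hasDerivAt_f (y θ : ℝ) : HasDerivAt (fun t => M.f y t) (M.fDeriv y θ) θ :=
  ((M.f_smooth y).differentiable (by norm_num) θ).hasDerivAt

lemma hasDerivAt_fDeriv (y θ : ℝ) : HasDerivAt (M.fDeriv y) (M.fDeriv2 y θ) θ := by
  have h : ContDiff ℝ 1 (deriv fun t => M.f y t) := (M.f_smooth y).deriv' (n := 1)
  exact (h.differentiable (by norm_num) θ).hasDerivAt

lemma exists_taylor_abs_le (y δ : ℝ) :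
    ∃ r ∈ Set.Icc (0 : ℝ) 1, |M.f y (M.θ0 + δ) - M.f y M.θ0 - δ * M.fDeriv y M.θ0|
      ≤ δ ^ 2 * |M.fDeriv2 y (M.θ0 + r * δ)| := by
  obtain ⟨r, hr, h1⟩ := exists_segment_deriv_eq (a := M.θ0) (d := δ)
    fun r _ => M.hasDerivAt_f y (M.θ0 + r * δ)
  obtain ⟨s, hs, h2⟩ := exists_segment_deriv_eq (a := M.θ0) (d := r * δ)
    fun s _ => M.hasDerivAt_fDeriv y (M.θ0 + s * (r * δ))
  refine ⟨s * r, ⟨mul_nonneg hs.1.le hr.1.le, mul_le_one₀ hs.2.le hr.1.le hr.2.le⟩, ?_⟩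
  have h3 : M.f y (M.θ0 + δ) - M.f y M.θ0 - δ * M.fDeriv y M.θ0
      = r * (δ ^ 2 * M.fDeriv2 y (M.θ0 + s * r * δ)) := by
    rw [h1]
    rw [← mul_assoc s r δ] at h2
    linear_combination δ * h2
  rw [h3, abs_mul, abs_of_pos hr.1, abs_mul, abs_of_nonneg (sq_nonneg δ)]
  exact mul_le_of_le_one_left (by positivity) hr.2.le

/-- A radius such that around `θ0` the model is regular and the boundary is increasing. -/
def IsGoodRadius (ρ : ℝ) : Prop :=
  0 < ρ ∧ Metric.ball M.θ0 ρ ⊆ M.N ∧ MonotoneOn M.g (Metric.ball M.θ0 ρ)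

lemma exists_isGoodRadius : ∃ ρ, M.IsGoodRadius ρ := by
  have hc : Continuous (deriv M.g) := M.g_smooth.continuous_deriv le_rfl
  have h : ∀ᶠ θ in 𝓝 M.θ0, θ ∈ M.N ∧ 0 < deriv M.g θ := by
    filter_upwards [M.N_open.mem_nhds M.θ0_mem,
      hc.continuousAt.eventually_const_lt M.g_deriv_pos] with θ h1 h2 using ⟨h1, h2⟩
  obtain ⟨ρ, hρ, hb⟩ := Metric.eventually_nhds_iff_ball.1 h
  refine ⟨ρ, hρ, fun θ hθ => (hb θ hθ).1, ?_⟩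
  refine monotoneOn_of_deriv_nonneg (convex_ball _ _) M.g_smooth.continuous.continuousOn
    (M.g_smooth.differentiable (by norm_num)).differentiableOn fun θ hθ => ?_
  exact (hb θ (interior_subset hθ)).2.le

variable {M}

namespace IsGoodRadius

variable {ρ δ : ℝ}

lemma segment_mem {r : ℝ} (hδ : |δ| < ρ) (hr : r ∈ Set.Icc (0 : ℝ) 1) :
    M.θ0 + r * δ ∈ Metric.ball M.θ0 ρ := by
  rw [Metric.mem_ball, Real.dist_eq, add_sub_cancel_left, abs_mul, abs_of_nonneg hr.1]
  exact (mul_le_of_le_one_left (abs_nonneg _) hr.2).trans_lt hδ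

lemma add_mem (hδ : |δ| < ρ) : M.θ0 + δ ∈ Metric.ball M.θ0 ρ := by
  simpa using segment_mem (M := M) hδ (Set.right_mem_Icc.2 zero_le_one)

lemma g_segment_le (hρ : M.IsGoodRadius ρ) {r : ℝ} (hδ : |δ| < ρ) (hr : r ∈ Set.Icc (0 : ℝ) 1) :
    M.g (M.θ0 + r * δ) ≤ max (M.g (M.θ0 + δ)) (M.g M.θ0) := by
  rcases le_total 0 δ with h | h
  · exact le_max_of_le_left (hρ.2.2 (segment_mem hδ hr) (add_mem hδ)
      (by nlinarith [hr.2]))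
  · exact le_max_of_le_right (hρ.2.2 (segment_mem hδ hr) (Metric.mem_ball_self hρ.1)
      (by nlinarith [hr.1]))

lemma exists_sqrt_sub_sq_le (hρ : M.IsGoodRadius ρ) (hδ : |δ| < ρ) (y : ℝ) :
    ∃ r ∈ Set.Icc (0 : ℝ) 1, (√(M.f y (M.θ0 + δ)) - √(M.f y M.θ0)) ^ 2
      ≤ δ ^ 2 * (M.fDeriv y (M.θ0 + r * δ) ^ 2 / M.f y (M.θ0 + r * δ) ^ 2
        * M.f y (M.θ0 + r * δ)) := by
  obtain ⟨r, hr, h1⟩ := exists_segment_deriv_eq (a := M.θ0) (d := δ)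
    (F := fun t => √(M.f y t)) (F' := fun t => M.fDeriv y t / (2 * √(M.f y t)))
    fun r hr => (M.hasDerivAt_f y (M.θ0 + r * δ)).sqrt
      (M.f_pos _ (hρ.2.1 (segment_mem hδ hr)) y).ne'
  refine ⟨r, Set.Ioo_subset_Icc_self hr, ?_⟩
  have hp := M.f_pos _ (hρ.2.1 (segment_mem hδ (Set.Ioo_subset_Icc_self hr))) y
  have h2 : (M.fDeriv y (M.θ0 + r * δ) / (2 * √(M.f y (M.θ0 + r * δ))) * δ) ^ 2
      = δ ^ 2 * (M.fDeriv y (M.θ0 + r * δ) ^ 2 / M.f y (M.θ0 + r * δ) ^ 2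
        * M.f y (M.θ0 + r * δ)) / 4 := by
    rw [mul_pow, div_pow, mul_pow, Real.sq_sqrt hp.le]
    field_simp
    ring
  rw [h1, h2]
  have : 0 ≤ δ ^ 2 * (M.fDeriv y (M.θ0 + r * δ) ^ 2 / M.f y (M.θ0 + r * δ) ^ 2
        * M.f y (M.θ0 + r * δ)) := by positivity
  linarith

/-- A pointwise bound by `δ² k(y, θ')`, with `θ'` on the segment, integrates to a quadratic bound
whenever `k` has an integrable supremum. -/
lemma abs_setIntegral_le (hρ : M.IsGoodRadius ρ) {k : ℝ → ℝ → ℝ} {G : ℝ → ENNReal}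
    (hG : ∫⁻ y, G y < ⊤)
    (hk : ∀ y, ∀ θ ∈ M.N, M.g θ ≤ y → ENNReal.ofReal (k y θ) ≤ G y) {u : ℝ → ℝ}
    (hδ : |δ| < ρ)
    (hu : ∀ y, ∃ r ∈ Set.Icc (0 : ℝ) 1, |u y| ≤ δ ^ 2 * k y (M.θ0 + r * δ)) :
    |∫ y in Set.Ici (max (M.g (M.θ0 + δ)) (M.g M.θ0)), u y| ≤ δ ^ 2 * (∫⁻ y, G y).toReal := by
  have h1 : ∫⁻ y in Set.Ici (max (M.g (M.θ0 + δ)) (M.g M.θ0)), ENNReal.ofReal ‖u y‖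
      ≤ ENNReal.ofReal (δ ^ 2) * ∫⁻ y, G y := by
    rw [← lintegral_const_mul' _ _ ENNReal.ofReal_ne_top]
    refine (setLIntegral_mono' measurableSet_Ici fun y hy => ?_).trans (setLIntegral_le_lintegral _ _)
    obtain ⟨r, hr, h⟩ := hu y
    refine (ENNReal.ofReal_le_ofReal h).trans ?_
    rw [ENNReal.ofReal_mul (sq_nonneg δ)]
    gcongr
    exact hk y _ (hρ.2.1 (segment_mem hδ hr)) ((hρ.g_segment_le hδ hr).trans hy)
  refine (norm_integral_le_lintegral_norm u).trans ?_
  refine (ENNReal.toReal_mono (ENNReal.mul_ne_top ENNReal.ofReal_ne_top hG.ne) h1).trans ?_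
  rw [ENNReal.toReal_mul, ENNReal.toReal_ofReal (sq_nonneg δ)]

lemma exists_taylor_bound (hρ : M.IsGoodRadius ρ) : ∃ K, ∀ δ, |δ| < ρ →
    |∫ y in Set.Ici (max (M.g (M.θ0 + δ)) (M.g M.θ0)),
      (M.f y (M.θ0 + δ) - M.f y M.θ0 - δ * M.fDeriv y M.θ0)| ≤ δ ^ 2 * K := by
  refine ⟨_, fun δ hδ => hρ.abs_setIntegral_le (k := fun y θ => |M.fDeriv2 y θ|) M.int3 ?_ hδ
    fun y => M.exists_taylor_abs_le y δ⟩
  intro y θ hθ hy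
  refine le_iSup₂_of_le θ hθ (le_iSup₂_of_le θ hθ (ENNReal.ofReal_le_ofReal ?_))
  rw [if_pos hy, mul_one, div_mul_cancel₀ _ (M.f_pos θ hθ y).ne']
  exact le_rfl

lemma exists_hellinger_bound (hρ : M.IsGoodRadius ρ) : ∃ K, ∀ δ, |δ| < ρ →
    |∫ y in Set.Ici (max (M.g (M.θ0 + δ)) (M.g M.θ0)),
      (√(M.f y (M.θ0 + δ)) - √(M.f y M.θ0)) ^ 2| ≤ δ ^ 2 * K := by
  refine ⟨_, fun δ hδ => hρ.abs_setIntegral_le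
    (k := fun y θ => M.fDeriv y θ ^ 2 / M.f y θ ^ 2 * M.f y θ) M.int2 ?_ hδ
    fun y => ?_⟩
  · intro y θ hθ hy
    refine le_iSup₂_of_le θ hθ (le_iSup₂_of_le θ hθ (ENNReal.ofReal_le_ofReal ?_))
    rw [if_pos hy, mul_one]
    exact le_rfl
  · obtain ⟨r, hr, h⟩ := hρ.exists_sqrt_sub_sq_le hδ y
    exact ⟨r, hr, by rwa [abs_of_nonneg (sq_nonneg _)]⟩

end IsGoodRadius

variable (M)

lemma integrableOn_fDeriv : IntegrableOn (fun y => M.fDeriv y M.θ0) (Set.Ici (M.g M.θ0)) := by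
  refine ⟨(M.fθ_cont _ M.θ0_mem).aestronglyMeasurable, ?_⟩
  refine lt_of_le_of_lt ((setLIntegral_mono' measurableSet_Ici fun y hy => ?_).trans
    (setLIntegral_le_lintegral _ _)) M.int1
  rw [Real.enorm_eq_ofReal_abs]
  refine le_iSup₂_of_le M.θ0 M.θ0_mem (ENNReal.ofReal_le_ofReal ?_)
  rw [if_pos (show M.g M.θ0 ≤ y from hy), mul_one]
  exact le_rfl

/-- Differentiating `∫ f(y|θ) 𝟙{y ≥ g(θ)} dy = 1` at `θ0`: the expected score is `1/λ`. -/
lemma integral_fDeriv : ∫ y in Set.Ici (M.g M.θ0), M.fDeriv y M.θ0 = M.lam⁻¹ := by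
  obtain ⟨ρ, hρ⟩ := M.exists_isGoodRadius
  obtain ⟨K, hK⟩ := hρ.exists_taylor_bound
  set I := ∫ y in Set.Ici (M.g M.θ0), M.fDeriv y M.θ0
  have hfc := M.f_cont _ M.θ0_mem
  have hDc : Continuous fun y => M.fDeriv y M.θ0 := M.fθ_cont _ M.θ0_mem
  let J : ℝ → ℝ := fun δ => (∫ y in (M.g M.θ0)..(M.g (M.θ0 + δ)), M.f y M.θ0)
    - δ * (I - ∫ y in (M.g M.θ0)..(M.g (M.θ0 + δ)), M.fDeriv y M.θ0)
  have hJ : ∀ δ, 0 ≤ δ → δ < ρ → |J δ| ≤ δ ^ 2 * K := by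
    intro δ h0 hδ
    have hδ' : |δ| < ρ := by rwa [abs_of_nonneg h0]
    have hg : M.g M.θ0 ≤ M.g (M.θ0 + δ) :=
      hρ.2.2 (Metric.mem_ball_self hρ.1) (IsGoodRadius.add_mem hδ') (by linarith)
    have hsub : Set.Ici (M.g (M.θ0 + δ)) ⊆ Set.Ici (M.g M.θ0) := Set.Ici_subset_Ici.2 hg
    have hf1 := M.f_integrable (M.θ0 + δ)
    have hf0 := M.f_integrable M.θ0
    have hD := M.integrableOn_fDeriv
    have e1 := intervalIntegral.integral_Ioi_sub_Ioi (hf0.mono_set Set.Ioi_subset_Ici_self) hg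
    have e2 := intervalIntegral.integral_Ioi_sub_Ioi (hD.mono_set Set.Ioi_subset_Ici_self) hg
    simp only [← integral_Ici_eq_integral_Ioi, M.f_density] at e1 e2
    have h := hK δ hδ'
    rw [max_eq_left hg, integral_sub_sub_const_mul hf1 (hf0.mono_set hsub)
      (hD.mono_set hsub), M.f_density] at h
    convert h using 2
    simp only [J]
    rw [← e1, ← e2]
    ring
  have hgd : HasDerivAt (fun δ => M.g (M.θ0 + δ)) (deriv M.g M.θ0) 0 := by
    have := (M.g_smooth.differentiable (by norm_num) (M.θ0 + 0)).hasDerivAt.comp_const_add M.θ0 0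
    simpa using this
  have hcomp : ∀ u : ℝ → ℝ, Continuous u →
      HasDerivAt (fun δ => ∫ y in (M.g M.θ0)..(M.g (M.θ0 + δ)), u y)
        (u (M.g M.θ0) * deriv M.g M.θ0) 0 := by
    intro u hu
    have h1 : HasDerivAt (fun b => ∫ y in (M.g M.θ0)..b, u y) (u (M.g M.θ0)) (M.g (M.θ0 + 0)) := by
      rw [add_zero]
      exact intervalIntegral.integral_hasDerivAt_right (hu.intervalIntegrable _ _)
        hu.stronglyMeasurable.stronglyMeasurableAtFilter hu.continuousAt
    exact h1.comp 0 hgd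
  have hJd : HasDerivAt J (M.f (M.g M.θ0) M.θ0 * deriv M.g M.θ0 - I) 0 := by
    have := (hcomp _ hfc).sub ((hasDerivAt_id (0 : ℝ)).mul ((hcomp _ hDc).const_sub I))
    simpa [J, Pi.sub_def, Pi.mul_def] using this
  have hlim := (hasDerivAt_iff_tendsto_slope.1 hJd).mono_left
    (nhdsWithin_mono (0 : ℝ) (show Set.Ioi (0 : ℝ) ⊆ {0}ᶜ from fun x hx => ne_of_gt hx))
  have hz : Tendsto (slope J 0) (𝓝[>] 0) (𝓝 0) := by
    have hb : Tendsto (fun δ : ℝ => δ * K) (𝓝[>] 0) (𝓝 0) := by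
      have : Tendsto (fun δ : ℝ => δ * K) (𝓝 0) (𝓝 (0 * K)) := tendsto_id.mul_const K
      rw [zero_mul] at this
      exact this.mono_left nhdsWithin_le_nhds
    refine squeeze_zero_norm' ?_ hb
    filter_upwards [Ioo_mem_nhdsGT hρ.1] with δ hδ
    have h0 : J 0 = 0 := by simp [J]
    rw [slope_def_field, h0, sub_zero, sub_zero, Real.norm_eq_abs, abs_div, abs_of_pos hδ.1,
      div_le_iff₀ hδ.1]
    exact (hJ δ hδ.1.le hδ.2).trans_eq (by ring)
  have := tendsto_nhds_unique hlim hz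
  rw [lam, inv_inv]
  linarith

/-- The mass `∫_{y ≥ g(θ0)} f(y|θ) dy`. -/
def mass (θ : ℝ) : ℝ := ∫ y in Set.Ici (M.g M.θ0), M.f y θ

/-- The affinity `∫_{y ≥ g(θ0)} √(f(y|θ) f(y|θ0)) dy`. -/
def affinity (θ : ℝ) : ℝ := ∫ y in Set.Ici (M.g M.θ0), √(M.f y θ * M.f y M.θ0)

variable {M}

lemma IsGoodRadius.g_le {ρ δ : ℝ} (hρ : M.IsGoodRadius ρ) (hδ : |δ| < ρ) (h0 : δ ≤ 0) :
    M.g (M.θ0 + δ) ≤ M.g M.θ0 :=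
  hρ.2.2 (add_mem hδ) (Metric.mem_ball_self hρ.1) (by linarith)

lemma IsGoodRadius.integrableOn_f {ρ δ : ℝ} (hρ : M.IsGoodRadius ρ) (hδ : |δ| < ρ) (h0 : δ ≤ 0) :
    IntegrableOn (fun y => M.f y (M.θ0 + δ)) (Set.Ici (M.g M.θ0)) :=
  (M.f_integrable _).mono_set (Set.Ici_subset_Ici.2 (hρ.g_le hδ h0))

lemma integrableOn_sqrt_mul {θ : ℝ} (hθ : θ ∈ M.N)
    (hi : IntegrableOn (fun y => M.f y θ) (Set.Ici (M.g M.θ0))) :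
    IntegrableOn (fun y => √(M.f y θ * M.f y M.θ0)) (Set.Ici (M.g M.θ0)) := by
  refine (hi.add (M.f_integrable M.θ0)).mono'
    ((M.f_cont θ hθ).mul (M.f_cont _ M.θ0_mem)).sqrt.aestronglyMeasurable ?_
  refine ae_of_all _ fun y => ?_
  have h1 := M.f_pos θ hθ y
  have h2 := M.f_pos _ M.θ0_mem y
  rw [Real.norm_eq_abs, abs_of_nonneg (Real.sqrt_nonneg _)]
  refine Real.sqrt_le_iff.2 ⟨by simp only [Pi.add_apply]; positivity, ?_⟩
  simp only [Pi.add_apply]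
  nlinarith

lemma IsGoodRadius.exists_mass_bound {ρ : ℝ} (hρ : M.IsGoodRadius ρ) :
    ∃ K, ∀ δ, |δ| < ρ → δ ≤ 0 → |M.mass (M.θ0 + δ) - 1 - δ * M.lam⁻¹| ≤ δ ^ 2 * K := by
  obtain ⟨K, hK⟩ := hρ.exists_taylor_bound
  refine ⟨K, fun δ hδ h0 => ?_⟩
  have h := hK δ hδ
  rw [max_eq_right (hρ.g_le hδ h0), integral_sub_sub_const_mul (hρ.integrableOn_f hδ h0)
    (M.f_integrable M.θ0) M.integrableOn_fDeriv, M.f_density, M.integral_fDeriv] at h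
  exact h

lemma IsGoodRadius.exists_affinity_bound {ρ : ℝ} (hρ : M.IsGoodRadius ρ) :
    ∃ K, ∀ δ, |δ| < ρ → δ ≤ 0 →
      |M.mass (M.θ0 + δ) + 1 - 2 * M.affinity (M.θ0 + δ)| ≤ δ ^ 2 * K := by
  obtain ⟨K, hK⟩ := hρ.exists_hellinger_bound
  refine ⟨K, fun δ hδ h0 => ?_⟩
  have h := hK δ hδ
  have hN := hρ.2.1 (add_mem hδ)
  have hi := hρ.integrableOn_f hδ h0
  have e : ∀ y, (√(M.f y (M.θ0 + δ)) - √(M.f y M.θ0)) ^ 2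
      = M.f y (M.θ0 + δ) + M.f y M.θ0 - 2 * √(M.f y (M.θ0 + δ) * M.f y M.θ0) := fun y => by
    have h1 := (M.f_pos _ hN y).le
    have h2 := (M.f_pos _ M.θ0_mem y).le
    rw [sub_sq, Real.sq_sqrt h1, Real.sq_sqrt h2, Real.sqrt_mul h1]
    ring
  simp only [e] at h
  rw [max_eq_right (hρ.g_le hδ h0), integral_add_sub_const_mul hi (M.f_integrable M.θ0)
    (integrableOn_sqrt_mul hN hi), M.f_density] at h
  exact h

/-- Local alternatives eventually lie in any ball around zero. -/
lemma eventually_abs_div_lt {ρ : ℝ} (hρ : 0 < ρ) (h : ℝ) : ∀ᶠ n : ℕ in atTop, |h / n| < ρ := by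
  have := (tendsto_const_div_atTop_nhds_zero_nat h).abs
  rw [abs_zero] at this
  exact this.eventually_lt_const hρ

/-- A first-order expansion at rate `δ²` gives the exponential limit of the `n`-th power. -/
lemma tendsto_pow_of_quadratic_bound {G : ℝ → ℝ} {b K ρ h : ℝ} (hρ : 0 < ρ) (hh : h ≤ 0)
    (hG : ∀ δ, |δ| < ρ → δ ≤ 0 → |G δ - 1 - δ * b| ≤ δ ^ 2 * K) :
    Tendsto (fun n : ℕ => G (h / n) ^ n) atTop (𝓝 (exp (h * b))) := by
  have key : Tendsto (fun n : ℕ => (n : ℝ) * (G (h / n) - 1)) atTop (𝓝 (h * b)) := by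
    rw [tendsto_iff_norm_sub_tendsto_zero]
    refine squeeze_zero' (Eventually.of_forall fun _ => norm_nonneg _) ?_
      (tendsto_const_div_atTop_nhds_zero_nat (h ^ 2 * K))
    filter_upwards [eventually_abs_div_lt hρ h, eventually_gt_atTop 0] with n hn hpos
    have hn0 : (0 : ℝ) < n := by exact_mod_cast hpos
    have hb := hG (h / n) hn (div_nonpos_of_nonpos_of_nonneg hh hn0.le)
    have e : (n : ℝ) * (G (h / n) - 1) - h * b = n * (G (h / n) - 1 - h / n * b) := by
      field_simp
    rw [e, Real.norm_eq_abs, abs_mul, abs_of_pos hn0]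
    refine (mul_le_mul_of_nonneg_left hb hn0.le).trans_eq ?_
    field_simp
  simpa using Real.tendsto_one_add_pow_exp_of_tendsto key

variable (M)

lemma tendsto_mass_pow {h : ℝ} (hh : h ≤ 0) :
    Tendsto (fun n : ℕ => M.mass (M.θ0 + h / n) ^ n) atTop (𝓝 (exp (h / M.lam))) := by
  obtain ⟨ρ, hρ⟩ := M.exists_isGoodRadius
  obtain ⟨K, hK⟩ := hρ.exists_mass_bound
  exact tendsto_pow_of_quadratic_bound (G := fun δ => M.mass (M.θ0 + δ)) hρ.1 hh hK

lemma tendsto_affinity_pow {h : ℝ} (hh : h ≤ 0) :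
    Tendsto (fun n : ℕ => M.affinity (M.θ0 + h / n) ^ n) atTop (𝓝 √(exp (h / M.lam))) := by
  obtain ⟨ρ, hρ⟩ := M.exists_isGoodRadius
  obtain ⟨K, hK⟩ := hρ.exists_mass_bound
  obtain ⟨K', hK'⟩ := hρ.exists_affinity_bound
  have e : √(exp (h / M.lam)) = exp (h * (M.lam⁻¹ / 2)) := by
    rw [← Real.exp_half]
    congr 1
    ring
  rw [e]
  refine tendsto_pow_of_quadratic_bound (G := fun δ => M.affinity (M.θ0 + δ))
    (K := (K + K') / 2) hρ.1 hh fun δ hδ h0 => ?_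
  have h1 := abs_le.1 (hK δ hδ h0)
  have h2 := abs_le.1 (hK' δ hδ h0)
  exact abs_le.2 ⟨by linarith [h1.1, h2.2], by linarith [h1.2, h2.1]⟩

end BenchmarkModel

namespace BenchmarkModel

variable (M : BenchmarkModel)

/-- The product density `∏ f(y_i|θ) 𝟙{y_i ≥ a}` with an arbitrary truncation point `a`. -/
def truncDensity (n : ℕ) (a θ : ℝ) (y : Fin n → ℝ) : ℝ :=
  ∏ i, M.f (y i) θ * if a ≤ y i then 1 else 0

variable {M} {n : ℕ} {a θ : ℝ}

lemma mul_ite_eq_indicator (u : ℝ → ℝ) (a : ℝ) :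
    (fun y => u y * if a ≤ y then 1 else 0) = (Set.Ici a).indicator u := by
  ext y
  by_cases h : a ≤ y <;> simp [h]

lemma measurable_truncDensity (hθ : θ ∈ M.N) : Measurable (M.truncDensity n a θ) := by
  have h : Measurable fun y => M.f y θ * if a ≤ y then 1 else 0 := by
    rw [mul_ite_eq_indicator]
    exact (M.f_cont θ hθ).measurable.indicator measurableSet_Ici
  exact Finset.measurable_prod _ fun i _ => h.comp (measurable_pi_apply i)

lemma truncDensity_nonneg (hθ : θ ∈ M.N) (y : Fin n → ℝ) : 0 ≤ M.truncDensity n a θ y :=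
  Finset.prod_nonneg fun i _ =>
    mul_nonneg (M.f_pos θ hθ _).le (by split_ifs <;> norm_num)

lemma truncDensity_of_forall_le {y : Fin n → ℝ} (h : ∀ i, a ≤ y i) :
    M.truncDensity n a θ y = ∏ i, M.f (y i) θ :=
  Finset.prod_congr rfl fun i _ => by rw [if_pos (h i), mul_one]

lemma truncDensity_of_exists_lt {y : Fin n → ℝ} (h : ∃ i, y i < a) :
    M.truncDensity n a θ y = 0 := by
  obtain ⟨i, hi⟩ := h
  exact Finset.prod_eq_zero (Finset.mem_univ i) (by rw [if_neg hi.not_ge, mul_zero])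

lemma integrable_prod_mul_ite {u : ℝ → ℝ} (hu : IntegrableOn u (Set.Ici a)) :
    Integrable fun y : Fin n → ℝ => ∏ i, (u (y i) * if a ≤ y i then 1 else 0) := by
  refine Integrable.fintype_prod (f := fun _ y => u y * if a ≤ y then 1 else 0) fun _ => ?_
  rw [mul_ite_eq_indicator]
  exact (integrable_indicator_iff measurableSet_Ici).2 hu

lemma integral_prod_mul_ite (u : ℝ → ℝ) :
    ∫ y : Fin n → ℝ, ∏ i, (u (y i) * if a ≤ y i then 1 else 0)
      = (∫ y in Set.Ici a, u y) ^ n := by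
  rw [integral_fintype_prod_volume_eq_pow (fun y => u y * if a ≤ y then 1 else 0),
    mul_ite_eq_indicator, integral_indicator measurableSet_Ici, Fintype.card_fin]

lemma integrable_truncDensity (h : IntegrableOn (fun y => M.f y θ) (Set.Ici a)) :
    Integrable (M.truncDensity n a θ) := integrable_prod_mul_ite h

lemma integral_truncDensity_boundary : ∫ y, M.truncDensity n (M.g θ) θ y = 1 := by
  refine (integral_prod_mul_ite fun y => M.f y θ).trans ?_
  rw [M.f_density, one_pow]

lemma integral_truncDensity : ∫ y, M.truncDensity n (M.g M.θ0) θ y = M.mass θ ^ n :=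
  integral_prod_mul_ite fun y => M.f y θ

lemma integral_P (hθ : θ ∈ M.N) (u : (Fin n → ℝ) → ℝ) :
    ∫ y, u y ∂M.P n θ = ∫ y, u y * M.truncDensity n (M.g θ) θ y := by
  have hm : Measurable fun y => ENNReal.ofReal (M.truncDensity n (M.g θ) θ y) :=
    (measurable_truncDensity hθ).ennreal_ofReal
  refine (integral_withDensity_eq_integral_toReal_smul hm
    (ae_of_all _ fun _ => ENNReal.ofReal_lt_top) u).trans ?_
  refine integral_congr_ae (ae_of_all _ fun y => ?_)
  simp only [smul_eq_mul]
  rw [ENNReal.toReal_ofReal (truncDensity_nonneg hθ y), mul_comm]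

lemma truncDensity_le (hθ : θ ∈ M.N) {b : ℝ} (hab : a ≤ b) (y : Fin n → ℝ) :
    M.truncDensity n b θ y ≤ M.truncDensity n a θ y := by
  by_cases h : ∀ i, b ≤ y i
  · rw [truncDensity_of_forall_le h, truncDensity_of_forall_le fun i => hab.trans (h i)]
  · push Not at h
    rw [truncDensity_of_exists_lt h]
    exact truncDensity_nonneg hθ y

/-- The `L¹` distance between the truncated alternative and `c` times the null density is
controlled by Hellinger-type quantities. -/
lemma integral_abs_truncDensity_sub_le (hθ : θ ∈ M.N)
    (hi : IntegrableOn (fun y => M.f y θ) (Set.Ici (M.g M.θ0))) {c : ℝ} (hc : 0 ≤ c) :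
    ∫ y, |M.truncDensity n (M.g M.θ0) θ y - c * M.truncDensity n (M.g M.θ0) M.θ0 y|
      ≤ √((M.mass θ ^ n + c - 2 * √c * M.affinity θ ^ n)
        * (M.mass θ ^ n + c + 2 * √c * M.affinity θ ^ n)) := by
  set w := M.truncDensity n (M.g M.θ0) θ
  set q := M.truncDensity n (M.g M.θ0) M.θ0
  have hw0 : ∀ y, 0 ≤ w y := truncDensity_nonneg hθ
  have hq0 : ∀ y, 0 ≤ q y := truncDensity_nonneg M.θ0_mem
  have hwm : Measurable w := measurable_truncDensity hθ
  have hqm : Measurable q := measurable_truncDensity M.θ0_mem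
  have hwi : Integrable w := integrable_truncDensity hi
  have hqi : Integrable q := integrable_truncDensity (M.f_integrable _)
  let s : (Fin n → ℝ) → ℝ := fun y =>
    ∏ i, (√(M.f (y i) θ * M.f (y i) M.θ0) * if M.g M.θ0 ≤ y i then 1 else 0)
  have hsi : Integrable s := integrable_prod_mul_ite (integrableOn_sqrt_mul hθ hi)
  have hs : ∫ y, s y = M.affinity θ ^ n :=
    integral_prod_mul_ite fun y => √(M.f y θ * M.f y M.θ0)
  have hw : ∫ y, w y = M.mass θ ^ n := integral_truncDensity
  have hq : ∫ y, q y = 1 := integral_truncDensity_boundary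
  have hsq : ∀ y, √(w y) * √(q y) = s y := fun y => by
    have h0 : 0 ≤ s y := Finset.prod_nonneg fun i _ =>
      mul_nonneg (Real.sqrt_nonneg _) (by split_ifs <;> norm_num)
    have h1 : s y ^ 2 = w y * q y := by
      simp only [s, w, q, truncDensity]
      rw [← Finset.prod_pow, ← Finset.prod_mul_distrib]
      refine Finset.prod_congr rfl fun i _ => ?_
      rw [mul_pow, Real.sq_sqrt (mul_pos (M.f_pos _ hθ _) (M.f_pos _ M.θ0_mem _)).le]
      split_ifs <;> ring
    rw [← Real.sqrt_mul (hw0 y), ← h1, Real.sqrt_sq h0]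
  let u : (Fin n → ℝ) → ℝ := fun y => √(w y) - √c * √(q y)
  let v : (Fin n → ℝ) → ℝ := fun y => √(w y) + √c * √(q y)
  have hcq : Integrable fun y => c * q y := hqi.const_mul c
  have hu2 : (fun y => u y ^ 2) = fun y => w y + c * q y - 2 * √c * s y := by
    ext y
    rw [← hsq y]
    linear_combination Real.sq_sqrt (hw0 y) + Real.sq_sqrt hc * q y
      + √c ^ 2 * Real.sq_sqrt (hq0 y)
  have hv2 : (fun y => v y ^ 2) = fun y => w y + c * q y - -(2 * √c) * s y := by
    ext y
    rw [← hsq y]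
    linear_combination Real.sq_sqrt (hw0 y) + Real.sq_sqrt hc * q y
      + √c ^ 2 * Real.sq_sqrt (hq0 y)
  have huv : ∀ y, u y * v y = w y - c * q y := fun y => by
    linear_combination Real.sq_sqrt (hw0 y) - Real.sq_sqrt hc * q y
      - √c ^ 2 * Real.sq_sqrt (hq0 y)
  have hint : ∀ b, Integrable fun y => w y + c * q y - b * s y := fun b =>
    (hwi.add hcq).sub (hsi.const_mul b)
  have huL : MemLp u 2 volume := (memLp_two_iff_integrable_sq (f := u)
    (hwm.sqrt.sub (hqm.sqrt.const_mul _)).aestronglyMeasurable).2 (hu2 ▸ hint _)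
  have hvL : MemLp v 2 volume := (memLp_two_iff_integrable_sq (f := v)
    (hwm.sqrt.add (hqm.sqrt.const_mul _)).aestronglyMeasurable).2 (hv2 ▸ hint _)
  have h := integral_abs_mul_le_sqrt huL hvL
  simp only [huv] at h
  rw [hu2, hv2, integral_add_sub_const_mul hwi hcq hsi, integral_add_sub_const_mul hwi hcq hsi,
    integral_const_mul, hw, hq, hs] at h
  simpa using h

/-- On the support of the null density the statistic is the ratio of the truncated densities. -/
lemma Z_mul_truncDensity {hb : ℝ} (hg : M.g (M.θ0 + hb / n) ≤ M.g M.θ0) (y : Fin n → ℝ) :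
    M.Z n 0 hb y * M.truncDensity n (M.g M.θ0) M.θ0 y
      = M.truncDensity n (M.g M.θ0) (M.θ0 + hb / n) y := by
  by_cases h : ∀ i, M.g M.θ0 ≤ y i
  · rw [truncDensity_of_forall_le h, truncDensity_of_forall_le h, Z]
    simp only [zero_div, add_zero]
    rw [if_pos h, if_pos fun i => hg.trans (h i), one_mul, ← Finset.prod_mul_distrib]
    exact Finset.prod_congr rfl fun i _ => div_mul_cancel₀ _ (M.f_pos _ M.θ0_mem _).ne'
  · push Not at h
    rw [truncDensity_of_exists_lt h, truncDensity_of_exists_lt h, mul_zero]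

lemma measurableSet_forall_le (a : ℝ) : MeasurableSet {y : Fin n → ℝ | ∀ i, a ≤ y i} := by
  rw [Set.ofPred_forall]
  exact MeasurableSet.iInter fun i => measurableSet_le measurable_const (measurable_pi_apply i)

lemma measurable_Z {hb : ℝ} (hN : M.θ0 + hb / n ∈ M.N) : Measurable (M.Z n 0 hb) := by
  have h0 : M.θ0 + 0 / n ∈ M.N := by simpa using M.θ0_mem
  refine Measurable.ite (measurableSet_forall_le _) (Measurable.mul
    (Measurable.ite (measurableSet_forall_le _) measurable_const measurable_const) ?_)
    measurable_const
  exact Finset.measurable_prod _ fun i _ =>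
    ((M.f_cont _ hN).measurable.comp (measurable_pi_apply i)).div
      ((M.f_cont _ h0).measurable.comp (measurable_pi_apply i))

lemma measurable_phiMinus {hb ε α : ℝ} (hN : M.θ0 + hb / n ∈ M.N) :
    Measurable (M.phiMinus n hb ε α) := by
  have hZ := measurable_Z hN
  have h : MeasurableSet {y : Fin n → ℝ |
      exp (hb / M.lam) * (1 + ε) < M.Z n 0 hb y ∨ ∃ i, y i < M.g M.θ0} := by
    have e : {y : Fin n → ℝ | exp (hb / M.lam) * (1 + ε) < M.Z n 0 hb y ∨ ∃ i, y i < M.g M.θ0}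
        = {y | exp (hb / M.lam) * (1 + ε) < M.Z n 0 hb y} ∪ {y | ∀ i, M.g M.θ0 ≤ y i}ᶜ := by
      ext y
      simp
    rw [e]
    exact (measurableSet_lt measurable_const hZ).union (measurableSet_forall_le _).compl
  exact Measurable.ite h measurable_const
    (Measurable.ite (hZ measurableSet_Icc) measurable_const measurable_const)

lemma phiMinus_mem_Icc {hb ε α : ℝ} (hα : α ∈ Set.Icc (0 : ℝ) 1) (y : Fin n → ℝ) :
    M.phiMinus n hb ε α y ∈ Set.Icc (0 : ℝ) 1 := by
  unfold phiMinus
  split_ifs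
  exacts [⟨zero_le_one, le_rfl⟩, hα, ⟨le_rfl, zero_le_one⟩]

lemma phiMinus_of_exists_lt {hb ε α : ℝ} {y : Fin n → ℝ} (h : ∃ i, y i < M.g M.θ0) :
    M.phiMinus n hb ε α y = 1 := if_pos (Or.inr h)

/-- The test deviates from `α` only where the likelihood ratio is away from its limit. -/
lemma abs_phiMinus_sub_le {hb ε α : ℝ} (hα : α ∈ Set.Icc (0 : ℝ) 1) (hε : 0 < ε)
    {y : Fin n → ℝ} (h : ∀ i, M.g M.θ0 ≤ y i) :
    exp (hb / M.lam) * ε * |M.phiMinus n hb ε α y - α| ≤ |M.Z n 0 hb y - exp (hb / M.lam)| := by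
  have hc := Real.exp_pos (hb / M.lam)
  set c := exp (hb / M.lam)
  have hn : ¬ ∃ i, y i < M.g M.θ0 := by push Not; exact h
  unfold phiMinus
  split_ifs with h1 h2
  · have h1 := h1.resolve_right hn
    rw [abs_of_nonneg (by linarith [hα.2])]
    refine le_trans ?_ (le_abs_self _)
    nlinarith [hα.1, mul_pos hc hε]
  · simp
  · rw [not_or, not_lt] at h1
    have h3 : M.Z n 0 hb y < c * (1 - ε) := by
      by_contra hcon
      exact h2 ⟨not_lt.1 hcon, h1.1⟩
    rw [zero_sub, abs_neg, abs_of_nonneg hα.1]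
    refine le_trans ?_ (neg_le_abs _)
    nlinarith [hα.2, mul_pos hc hε]

/-- Change of measure: up to the `L¹` error, a test integrates under the alternative to its mass
below the null boundary plus `c` times its null size. -/
lemma abs_integral_mul_sub_le (hθ : θ ∈ M.N) (hg : M.g θ ≤ M.g M.θ0) {c : ℝ}
    {ψ : (Fin n → ℝ) → ℝ} (hψm : Measurable ψ) (hψ : ∀ y, ψ y ∈ Set.Icc (0 : ℝ) 1) :
    |∫ y, ψ y ∂M.P n θ
      - (∫ y, ψ y * (M.truncDensity n (M.g θ) θ y - M.truncDensity n (M.g M.θ0) θ y))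
      - c * ∫ y, ψ y ∂M.P n M.θ0|
      ≤ ∫ y, |M.truncDensity n (M.g M.θ0) θ y - c * M.truncDensity n (M.g M.θ0) M.θ0 y| := by
  have hi : IntegrableOn (fun y => M.f y θ) (Set.Ici (M.g M.θ0)) :=
    (M.f_integrable θ).mono_set (Set.Ici_subset_Ici.2 hg)
  rw [integral_P hθ, integral_P M.θ0_mem]
  set p := M.truncDensity n (M.g θ) θ
  set w := M.truncDensity n (M.g M.θ0) θ
  set q := M.truncDensity n (M.g M.θ0) M.θ0
  have hpi : Integrable p := integrable_truncDensity (M.f_integrable _)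
  have hwi : Integrable w := integrable_truncDensity hi
  have hqi : Integrable q := integrable_truncDensity (M.f_integrable _)
  have hb : ∀ᵐ y, ‖ψ y‖ ≤ 1 := ae_of_all _ fun y => by
    rw [Real.norm_eq_abs, abs_of_nonneg (hψ y).1]
    exact (hψ y).2
  have hmul : ∀ {r : (Fin n → ℝ) → ℝ}, Integrable r → Integrable fun y => ψ y * r y := fun hr =>
    hr.bdd_mul hψm.aestronglyMeasurable hb
  have hpwi : Integrable fun y => p y - w y := hpi.sub hwi
  rw [← integral_sub_sub_const_mul (hmul hpi) (hmul hpwi) (hmul hqi)]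
  refine (abs_integral_le_integral_abs).trans ?_
  refine integral_mono_of_nonneg (ae_of_all _ fun _ => abs_nonneg _)
    (hwi.sub (hqi.const_mul c)).abs (ae_of_all _ fun y => ?_)
  have e : ψ y * p y - ψ y * (p y - w y) - c * (ψ y * q y) = ψ y * (w y - c * q y) := by ring
  simp only [e, abs_mul, abs_of_nonneg (hψ y).1]
  exact mul_le_of_le_one_left (abs_nonneg _) (hψ y).2

lemma integral_mul_sub_le (hθ : θ ∈ M.N) (hg : M.g θ ≤ M.g M.θ0)
    {ψ : (Fin n → ℝ) → ℝ} (hψ : ∀ y, ψ y ∈ Set.Icc (0 : ℝ) 1) :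
    ∫ y, ψ y * (M.truncDensity n (M.g θ) θ y - M.truncDensity n (M.g M.θ0) θ y)
      ≤ 1 - M.mass θ ^ n := by
  have hpi : Integrable (M.truncDensity n (M.g θ) θ) := integrable_truncDensity (M.f_integrable _)
  have hwi : Integrable (M.truncDensity n (M.g M.θ0) θ) := integrable_truncDensity
    ((M.f_integrable θ).mono_set (Set.Ici_subset_Ici.2 hg))
  have hnn := fun y : Fin n → ℝ => sub_nonneg.2 (truncDensity_le hθ hg y)
  rw [← integral_truncDensity_boundary (M := M) (n := n) (θ := θ),
    ← integral_truncDensity (M := M), ← integral_sub hpi hwi]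
  exact integral_mono_of_nonneg (ae_of_all _ fun y => mul_nonneg (hψ y).1 (hnn y))
    (hpi.sub hwi) (ae_of_all _ fun y => mul_le_of_le_one_left (hnn y) (hψ y).2)

lemma integral_phiMinus_mul_sub (hg : M.g θ ≤ M.g M.θ0) (hb ε α : ℝ) :
    ∫ y, M.phiMinus n hb ε α y
      * (M.truncDensity n (M.g θ) θ y - M.truncDensity n (M.g M.θ0) θ y)
      = 1 - M.mass θ ^ n := by
  have hpi : Integrable (M.truncDensity n (M.g θ) θ) := integrable_truncDensity (M.f_integrable _)
  have hwi : Integrable (M.truncDensity n (M.g M.θ0) θ) := integrable_truncDensity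
    ((M.f_integrable θ).mono_set (Set.Ici_subset_Ici.2 hg))
  rw [← integral_truncDensity_boundary (M := M) (n := n) (θ := θ),
    ← integral_truncDensity (M := M), ← integral_sub hpi hwi]
  refine integral_congr_ae (ae_of_all _ fun y => ?_)
  by_cases h : ∀ i, M.g M.θ0 ≤ y i
  · simp only
    rw [truncDensity_of_forall_le h, truncDensity_of_forall_le fun i => hg.trans (h i), sub_self,
      mul_zero]
  · push Not at h
    simp only [phiMinus_of_exists_lt h, one_mul]

variable (M)

lemma eventually_local_mem {h : ℝ} (hh : h ≤ 0) : ∀ᶠ n : ℕ in atTop,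
    M.θ0 + h / n ∈ M.N ∧ M.g (M.θ0 + h / n) ≤ M.g M.θ0 := by
  obtain ⟨ρ, hρ⟩ := M.exists_isGoodRadius
  filter_upwards [eventually_abs_div_lt hρ.1 h] with n hn
  exact ⟨hρ.2.1 (IsGoodRadius.add_mem hn),
    hρ.g_le hn (div_nonpos_of_nonpos_of_nonneg hh n.cast_nonneg)⟩

/-- The likelihood ratio converges to `exp (h / λ)` in `L¹` under the null. -/
lemma tendsto_integral_abs_sub {h : ℝ} (hh : h ≤ 0) :
    Tendsto (fun n : ℕ => ∫ y, |M.truncDensity n (M.g M.θ0) (M.θ0 + h / n) y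
      - exp (h / M.lam) * M.truncDensity n (M.g M.θ0) M.θ0 y|) atTop (𝓝 0) := by
  set c := exp (h / M.lam)
  have hc : 0 ≤ c := (Real.exp_pos _).le
  have hA := M.tendsto_mass_pow hh
  have hR := M.tendsto_affinity_pow hh
  have hlim := (((hA.add_const c).sub (hR.const_mul (2 * √c))).mul
    ((hA.add_const c).add (hR.const_mul (2 * √c)))).sqrt
  have e : √((c + c - 2 * √c * √c) * (c + c + 2 * √c * √c)) = 0 := by
    rw [mul_assoc, Real.mul_self_sqrt hc]
    simp [two_mul]
  rw [e] at hlim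
  refine squeeze_zero' (Eventually.of_forall fun n => integral_nonneg fun _ => abs_nonneg _) ?_ hlim
  filter_upwards [M.eventually_local_mem hh] with n hn
  exact integral_abs_truncDensity_sub_le hn.1
    ((M.f_integrable _).mono_set (Set.Ici_subset_Ici.2 hn.2)) hc

/-- The negative-side NLR test has asymptotic size exactly `α`. -/
lemma tendsto_integral_phiMinus_null {hb ε α : ℝ} (hb0 : hb ≤ 0) (hα : α ∈ Set.Icc (0 : ℝ) 1)
    (hε : 0 < ε) :
    Tendsto (fun n : ℕ => ∫ y, M.phiMinus n hb ε α y ∂M.P n M.θ0) atTop (𝓝 α) := by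
  set c := exp (hb / M.lam) with hc_def
  have hc : 0 < c := Real.exp_pos _
  have hlim := (M.tendsto_integral_abs_sub hb0).const_mul (c * ε)⁻¹
  rw [mul_zero] at hlim
  rw [tendsto_iff_norm_sub_tendsto_zero]
  refine squeeze_zero' (Eventually.of_forall fun n => norm_nonneg _) ?_ hlim
  filter_upwards [M.eventually_local_mem hb0] with n hn
  have hwi : Integrable (M.truncDensity n (M.g M.θ0) (M.θ0 + hb / n)) := integrable_truncDensity
    ((M.f_integrable _).mono_set (Set.Ici_subset_Ici.2 hn.2))
  have hqi : Integrable (M.truncDensity n (M.g M.θ0) M.θ0) :=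
    integrable_truncDensity (M.f_integrable _)
  have hφi : Integrable fun y => M.phiMinus n hb ε α y * M.truncDensity n (M.g M.θ0) M.θ0 y :=
    hqi.bdd_mul (measurable_phiMinus hn.1).aestronglyMeasurable (c := 1)
      (ae_of_all _ fun y => by
        have := phiMinus_mem_Icc (M := M) (hb := hb) (ε := ε) hα y
        rw [Real.norm_eq_abs, abs_of_nonneg this.1]
        exact this.2)
  have e : ∫ y, M.phiMinus n hb ε α y ∂M.P n M.θ0 - α
      = ∫ y, (M.phiMinus n hb ε α y - α) * M.truncDensity n (M.g M.θ0) M.θ0 y := by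
    simp only [sub_mul]
    rw [integral_sub hφi (hqi.const_mul α), integral_const_mul, integral_truncDensity_boundary,
      mul_one, integral_P M.θ0_mem]
  rw [e, ← integral_const_mul]
  refine (norm_integral_le_integral_norm _).trans ?_
  refine integral_mono_of_nonneg (ae_of_all _ fun _ => norm_nonneg _)
    ((hwi.sub (hqi.const_mul c)).abs.const_mul _) (ae_of_all _ fun y => ?_)
  simp only [Real.norm_eq_abs]
  rw [← Z_mul_truncDensity hn.2, ← sub_mul, abs_mul, abs_mul, ← mul_assoc]
  by_cases h : ∀ i, M.g M.θ0 ≤ y i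
  · gcongr
    rw [le_inv_mul_iff₀ (mul_pos hc hε)]
    exact abs_phiMinus_sub_le hα hε h
  · push Not at h
    simp [truncDensity_of_exists_lt h]

/-- The asymptotic power of the negative-side NLR test. -/
lemma tendsto_integral_phiMinus_local {hb ε α h : ℝ} (hb0 : hb ≤ 0) (hh : h ≤ 0)
    (hα : α ∈ Set.Icc (0 : ℝ) 1) (hε : 0 < ε) :
    Tendsto (fun n : ℕ => ∫ y, M.phiMinus n hb ε α y ∂M.P n (M.θ0 + h / n)) atTop
      (𝓝 (1 - exp (h / M.lam) + exp (h / M.lam) * α)) := by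
  have hlim := ((M.tendsto_mass_pow hh).const_sub 1).add
    ((M.tendsto_integral_phiMinus_null hb0 hα hε).const_mul (exp (h / M.lam)))
  refine tendsto_of_tendsto_of_dist hlim ?_
  refine squeeze_zero' (Eventually.of_forall fun n => dist_nonneg) ?_
    (M.tendsto_integral_abs_sub hh)
  filter_upwards [M.eventually_local_mem hh, M.eventually_local_mem hb0] with n hn hnb
  have := abs_integral_mul_sub_le (c := exp (h / M.lam)) hn.1 hn.2 (measurable_phiMinus hnb.1)
    (phiMinus_mem_Icc (M := M) (hb := hb) (ε := ε) hα)
  rw [integral_phiMinus_mul_sub hn.2] at this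
  rwa [dist_comm, Real.dist_eq, ← sub_sub]

/-- The asymptotic power envelope for tests of asymptotic level `α`. -/
lemma limsup_integral_local_le {α h : ℝ} (hh : h ≤ 0) {ψ : (n : ℕ) → (Fin n → ℝ) → ℝ}
    (hψm : ∀ n, Measurable (ψ n)) (hψ : ∀ n y, ψ n y ∈ Set.Icc (0 : ℝ) 1)
    (hlevel : limsup (fun n : ℕ => ∫ y, ψ n y ∂M.P n M.θ0) atTop ≤ α) :
    limsup (fun n : ℕ => ∫ y, ψ n y ∂M.P n (M.θ0 + h / n)) atTop
      ≤ 1 - exp (h / M.lam) + exp (h / M.lam) * α := by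
  set c := exp (h / M.lam) with hc_def
  have hc : 0 < c := Real.exp_pos _
  have hsize : ∀ n, ∫ y, ψ n y ∂M.P n M.θ0 ≤ 1 := fun n => by
    rw [integral_P M.θ0_mem, ← integral_truncDensity_boundary (M := M) (n := n) (θ := M.θ0)]
    exact integral_mono_of_nonneg
      (ae_of_all _ fun y => mul_nonneg (hψ n y).1 (truncDensity_nonneg M.θ0_mem y))
      (integrable_truncDensity (M.f_integrable _))
      (ae_of_all _ fun y => mul_le_of_le_one_left (truncDensity_nonneg M.θ0_mem y) (hψ n y).2)
  have hbdd : IsBoundedUnder (· ≤ ·) atTop fun n : ℕ => ∫ y, ψ n y ∂M.P n M.θ0 :=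
    isBoundedUnder_of ⟨1, hsize⟩
  have hcob : IsCoboundedUnder (· ≤ ·) atTop fun n : ℕ => ∫ y, ψ n y ∂M.P n (M.θ0 + h / n) :=
    (isBoundedUnder_of (r := (· ≥ ·)) ⟨0, fun n => integral_nonneg fun y =>
      (hψ n y).1⟩).isCoboundedUnder_le
  have key : ∀ b, α < b → limsup (fun n : ℕ => ∫ y, ψ n y ∂M.P n (M.θ0 + h / n)) atTop
      ≤ 1 - c + c * b + 0 := fun b hb => by
    have hlim := (((M.tendsto_mass_pow hh).const_sub 1).add_const (c * b)).add
      (M.tendsto_integral_abs_sub hh)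
    rw [← hlim.limsup_eq]
    refine limsup_le_limsup ?_ hcob hlim.isBoundedUnder_le
    filter_upwards [M.eventually_local_mem hh,
      eventually_lt_of_limsup_lt (hlevel.trans_lt hb) hbdd] with n hn hnb
    have h1 := (abs_le.1 (abs_integral_mul_sub_le (c := c) hn.1 hn.2 (hψm n) (hψ n))).2
    have h2 := integral_mul_sub_le hn.1 hn.2 (hψ n)
    have h3 := mul_le_mul_of_nonneg_left hnb.le hc.le
    simp only [← hc_def]
    linarith
  refine le_of_forall_pos_le_add fun η hη => ?_
  refine (key (α + η / c) (by linarith [div_pos hη hc])).trans_eq ?_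
  field_simp
  ring

end BenchmarkModel

namespace BenchmarkModel

/-- Theorem 2: with `h̄⁻ = −M`, the negative-side NLR test is asymptotically uniformly
most powerful at level `α` over local alternatives in `[−M, 0)`. -/
theorem nlr_minus_AUMP (M : BenchmarkModel) (α Mc ε : ℝ) (hα : α ∈ Set.Ioo (0 : ℝ) 1)
    (hMc : 0 < Mc) (hε : ε ∈ Set.Ioo (0 : ℝ) 1) :
    Filter.limsup (fun n : ℕ => ∫ y, M.phiMinus n (-Mc) ε α y ∂ M.P n M.θ0) atTop ≤ α ∧
    ∀ ψ : (n : ℕ) → (Fin n → ℝ) → ℝ,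
      (∀ n, Measurable (ψ n)) → (∀ n y, ψ n y ∈ Set.Icc (0 : ℝ) 1) →
      Filter.limsup (fun n : ℕ => ∫ y, ψ n y ∂ M.P n M.θ0) atTop ≤ α →
      ∀ h : ℝ, -Mc ≤ h → h < 0 →
        Filter.limsup (fun n : ℕ => ∫ y, ψ n y ∂ M.P n (M.θ0 + h / n)) atTop ≤
          Filter.liminf
            (fun n : ℕ => ∫ y, M.phiMinus n (-Mc) ε α y ∂ M.P n (M.θ0 + h / n)) atTop := by
  have hα' := Set.Ioo_subset_Icc_self hα
  have hb : -Mc ≤ 0 := by linarith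
  refine ⟨(M.tendsto_integral_phiMinus_null hb hα' hε.1).limsup_eq.le,
    fun ψ hψm hψ hlevel h _ hh => ?_⟩
  rw [(M.tendsto_integral_phiMinus_local hb hh.le hα' hε.1).liminf_eq]
  exact M.limsup_integral_local_le hh.le hψm hψ hlevel

end BenchmarkModel
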